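/- arXiv:1209.0921 — 2 statements merged into one kernel-verified Lean document; each statement's English description precedes it below -/
import Mathlib

section
/- (Twirl of the uniform superposition resource state coupled to e_±.) Let M ≥ 1. Work on ℂ^{M+1} ⊗ ℂ², with standard basis vectors |j,s⟩, and let T be the U(1)-twirl with respect to the total-number function n(j,s) = j + s. Let Ψ = (1/√(M+1))·Σ_{j=0}^M |j⟩ and e_± = (1/√2)(|0⟩ ± |1⟩). Then the twirled states ρ̄_± := T((Ψ ⊗ e_±)·(Ψ ⊗ e_±)^*) satisfy ρ̄_± = σ + (1/(M+1))·Σ_{n=1}^M |φ_n^±⟩⟨φ_n^±|, where σ = (1/(2(M+1)))·(|0,0⟩⟨0,0| + |M,1⟩⟨M,1|) and φ_n^± = (1/√2)·(|n,0⟩ ± |n−1,1⟩) for n = 1, …, M. -/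
open Matrix

/-- The U(1)-twirl (dephasing map) with respect to the diagonal matrix with
integer charges `n j`, for an arbitrary (finite) index type. -/
noncomputable def twirl {ι : Type*} (n : ι → ℤ) (ρ : Matrix ι ι ℂ) : Matrix ι ι ℂ :=
  Matrix.of fun j k => if n j = n k then ρ j k else 0

/-- Standard basis vector `|x⟩`. -/
noncomputable def ket {ι : Type*} [DecidableEq ι] (x : ι) : ι → ℂ :=
  fun p => if p = x then 1 else 0

/-- **Twirl of the uniform superposition resource state coupled to `e_±`.**
For `Ψ = (1/√(M+1)) Σ_j |j⟩` and `e_± = (|0⟩ ± |1⟩)/√2` (sign `ε = ±1`),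
`T((Ψ ⊗ e_±)(Ψ ⊗ e_±)^*) = σ + (1/(M+1)) Σ_{n=1}^M |φ_n^±⟩⟨φ_n^±|`, where
`σ = (1/(2(M+1)))(|0,0⟩⟨0,0| + |M,1⟩⟨M,1|)` and `φ_n^± = (|n,0⟩ ± |n-1,1⟩)/√2`. -/
theorem twirl_uniform_resource (M : ℕ) (hM : 1 ≤ M)
    (ε : ℂ) (hε : ε = 1 ∨ ε = -1)
    (ψ : Fin (M+1) × Fin 2 → ℂ)
    (hψ : ψ = fun p => ((Real.sqrt (M+1) : ℝ)⁻¹ : ℂ) * (((Real.sqrt 2 : ℝ)⁻¹ : ℂ) *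
      (if p.2 = 0 then 1 else ε)))
    (φ : Fin M → (Fin (M+1) × Fin 2 → ℂ))
    (hφ : ∀ i : Fin M, φ i = fun p =>
      ((Real.sqrt 2 : ℝ)⁻¹ : ℂ) * (ket ((i.succ, (0 : Fin 2)) : Fin (M+1) × Fin 2) p
        + ε * ket ((i.castSucc, (1 : Fin 2)) : Fin (M+1) × Fin 2) p))
    (σ : Matrix (Fin (M+1) × Fin 2) (Fin (M+1) × Fin 2) ℂ)
    (hσ : σ = ((1 / (2 * (M+1)) : ℝ) : ℂ) •
      (Matrix.vecMulVec (ket (((0 : Fin (M+1)), (0 : Fin 2)) : Fin (M+1) × Fin 2))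
          (star (ket (((0 : Fin (M+1)), (0 : Fin 2)) : Fin (M+1) × Fin 2)))
        + Matrix.vecMulVec (ket ((Fin.last M, (1 : Fin 2)) : Fin (M+1) × Fin 2))
          (star (ket ((Fin.last M, (1 : Fin 2)) : Fin (M+1) × Fin 2))))) :
    twirl (fun p : Fin (M+1) × Fin 2 => ((p.1 : ℕ) : ℤ) + ((p.2 : ℕ) : ℤ))
        (Matrix.vecMulVec ψ (star ψ))
      = σ + ((1 / (M+1) : ℝ) : ℂ) •
          ∑ i : Fin M, Matrix.vecMulVec (φ i) (star (φ i)) := by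
  have hεs : (starRingEnd ℂ) ε = ε := by rcases hε with h | h <;> simp [h]
  have hεε : ε * ε = 1 := by rcases hε with h | h <;> simp [h]
  have h2 : ((Real.sqrt 2 : ℝ)⁻¹ : ℂ) * ((Real.sqrt 2 : ℝ)⁻¹ : ℂ) = 1 / 2 := by
    rw [← mul_inv, ← Complex.ofReal_mul, Real.mul_self_sqrt (by norm_num)]; norm_num
  have hM1 : ((Real.sqrt (M+1) : ℝ)⁻¹ : ℂ) * ((Real.sqrt (M+1) : ℝ)⁻¹ : ℂ) = 1 / (M+1) := by
    rw [← mul_inv, ← Complex.ofReal_mul, Real.mul_self_sqrt (by positivity)]; norm_num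
  have hc : (starRingEnd ℂ) ((Real.sqrt 2 : ℝ)⁻¹ : ℂ) = ((Real.sqrt 2 : ℝ)⁻¹ : ℂ) := by
    rw [map_inv₀, Complex.conj_ofReal]
  have hd : (starRingEnd ℂ) ((Real.sqrt (M+1) : ℝ)⁻¹ : ℂ) = ((Real.sqrt (M+1) : ℝ)⁻¹ : ℂ) := by
    rw [map_inv₀, Complex.conj_ofReal]
  have hφ' : ∀ (i : Fin M) (p q : Fin (M+1) × Fin 2), Matrix.vecMulVec (φ i) (star (φ i)) p q =
      1 / 2 * ((ket (i.succ, (0 : Fin 2)) p + ε * ket (i.castSucc, (1 : Fin 2)) p) *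
        (ket (i.succ, (0 : Fin 2)) q + ε * ket (i.castSucc, (1 : Fin 2)) q)) := by
    intro i p q
    have hk : ∀ x y : Fin (M+1) × Fin 2, (starRingEnd ℂ) (ket x y) = ket x y := by
      intro x y; unfold ket; split_ifs <;> simp
    rw [← h2, Matrix.vecMulVec_apply, hφ i, Pi.star_apply, ← starRingEnd_apply, map_mul, hc,
      map_add, map_mul, hεs, hk, hk]
    ring
  have hψ' : ∀ (p q : Fin (M+1) × Fin 2), Matrix.vecMulVec ψ (star ψ) p q =
      1 / (M+1) * (1 / 2) * ((if p.2 = 0 then 1 else ε) * (if q.2 = 0 then 1 else ε)) := by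
    intro p q
    have hk : (starRingEnd ℂ) (if q.2 = 0 then 1 else ε) = (if q.2 = 0 then 1 else ε) := by
      split_ifs <;> simp [hεs]
    rw [← h2, ← hM1, Matrix.vecMulVec_apply, hψ, Pi.star_apply, ← starRingEnd_apply, map_mul, hd,
      map_mul, hc, hk]
    ring
  have hσ' : ∀ p q : Fin (M+1) × Fin 2, σ p q = 1 / (M+1) * (1 / 2) *
      (ket ((0 : Fin (M+1)), (0 : Fin 2)) p * ket ((0 : Fin (M+1)), (0 : Fin 2)) q
        + ket (Fin.last M, (1 : Fin 2)) p * ket (Fin.last M, (1 : Fin 2)) q) := by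
    intro p q
    have hk : ∀ x y : Fin (M+1) × Fin 2, (starRingEnd ℂ) (ket x y) = ket x y := by
      intro x y; unfold ket; split_ifs <;> simp
    rw [hσ, Matrix.smul_apply, Matrix.add_apply, Matrix.vecMulVec_apply, Matrix.vecMulVec_apply,
      Pi.star_apply, Pi.star_apply, ← starRingEnd_apply, ← starRingEnd_apply, hk, hk, smul_eq_mul]
    push_cast
    rw [one_div_mul_one_div, mul_comm (2 : ℂ)]
  ext ⟨a, s⟩ ⟨b, t⟩
  rw [Matrix.add_apply, Matrix.smul_apply, Matrix.sum_apply, hσ']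
  simp only [twirl, Matrix.of_apply, hψ', hφ', smul_eq_mul, ← Finset.mul_sum]
  push_cast
  rw [← mul_assoc (1 / ((M : ℂ) + 1)) (1 / 2) (Finset.sum _ _), ← mul_add]
  have key : (if ((a : ℕ) : ℤ) + ((s : ℕ) : ℤ) = ((b : ℕ) : ℤ) + ((t : ℕ) : ℤ) then
      ((if s = 0 then 1 else ε) * (if t = 0 then 1 else ε)) else 0) =
      (ket ((0 : Fin (M+1)), (0 : Fin 2)) (a, s) * ket ((0 : Fin (M+1)), (0 : Fin 2)) (b, t)
        + ket (Fin.last M, (1 : Fin 2)) (a, s) * ket (Fin.last M, (1 : Fin 2)) (b, t)) +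
      ∑ i : Fin M, ((ket (i.succ, (0 : Fin 2)) (a, s) + ε * ket (i.castSucc, (1 : Fin 2)) (a, s)) *
        (ket (i.succ, (0 : Fin 2)) (b, t) + ε * ket (i.castSucc, (1 : Fin 2)) (b, t))) := by
    have hz : ∀ i : Fin M, (0 : Fin (M+1)) ≠ i.succ := fun i => (Fin.succ_ne_zero i).symm
    have hl : ∀ i : Fin M, Fin.last M ≠ i.castSucc := fun i => (Fin.castSucc_ne_last i).symm
    have hi1 : ∀ i : Fin M, ¬ ((0 : ℤ) = (i : ℕ) + 1) := by intro i; omega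
    have hi2 : ∀ i : Fin M, ¬ (((i : ℕ) : ℤ) + 1 = 0) := by intro i; omega
    have hi3 : ∀ i : Fin M, ¬ ((i : ℕ) = M) := by intro i; omega
    have hi4 : ∀ i : Fin M, ¬ (M = (i : ℕ)) := by intro i; omega
    have hi5 : ¬ ((0 : ℤ) = (M : ℤ) + 1) := by omega
    have hi6 : ¬ ((M : ℤ) + 1 = 0) := by omega
    unfold ket
    fin_cases s <;> fin_cases t
    · induction a using Fin.cases <;> induction b using Fin.cases <;>
        simp [hz, hl, hεε, hi1, hi2, hi3, hi4, hi5, hi6, Fin.val_inj]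
    · induction a using Fin.cases <;> induction b using Fin.lastCases <;>
        simp [hz, hl, hεε, hi1, hi2, hi3, hi4, hi5, hi6, Fin.val_inj]
    · induction a using Fin.lastCases <;> induction b using Fin.cases <;>
        simp [hz, hl, hεε, hi1, hi2, hi3, hi4, hi5, hi6, Fin.val_inj]
    · induction a using Fin.lastCases <;> induction b using Fin.lastCases <;>
        simp [hz, hl, hεε, hi1, hi2, hi3, hi4, hi5, hi6, Fin.val_inj]
  rw [← key]
  split_ifs <;> simp
end

section
/- (Optimal unambiguous discrimination with a uniform-superposition resource succeeds with probability M/(M+1).) Let M ≥ 1 and work on ℂ^{M+1} ⊗ ℂ² with the U(1)-twirl T with respect to the total number n(j,s) = j+s. Let Ψ = (1/√(M+1))·Σ_{j=0}^M |j⟩, e_± = (1/√2)(|0⟩ ± |1⟩), ρ̄_± = T((Ψ ⊗ e_±)·(Ψ ⊗ e_±)^*), and φ_n^± = (1/√2)(|n,0⟩ ± |n−1,1⟩). Define F_± = Σ_{n=1}^M |φ_n^±⟩⟨φ_n^±| and F_* = |0,0⟩⟨0,0| + |M,1⟩⟨M,1|. Then: (i) F_+ + F_- + F_* = I; (ii)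 F_+·ρ̄_- = 0 and F_-·ρ̄_+ = 0 (no discrimination errors); (iii) trace(F_+·ρ̄_+) = trace(F_-·ρ̄_-) = M/(M+1); and (iv) trace(F_*·ρ̄_+) = trace(F_*·ρ̄_-) = 1/(M+1), so the protocol fails with probability exactly 1/(M+1). -/
open Matrix

lemma star_ket_aux {ι : Type*} [DecidableEq ι] (x : ι) : star (ket x) = ket x := by
  ext p
  simp only [ket, Pi.star_apply]
  split_ifs <;> simp

lemma ket_vecMul_aux {ι : Type*} [DecidableEq ι] [Fintype ι] (x : ι) (A : Matrix ι ι ℂ) :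
    ket x ᵥ* A = A x := by
  ext q
  simp [Matrix.vecMul, dotProduct, ket]

lemma sum_ket_aux {ι : Type*} [DecidableEq ι] [Fintype ι] :
    ∑ x : ι, Matrix.vecMulVec (ket x) (ket x) = (1 : Matrix ι ι ℂ) := by
  ext p q
  simp [Matrix.sum_apply, Matrix.vecMulVec_apply, ket, Matrix.one_apply]

lemma ket_dot_aux {ι : Type*} [DecidableEq ι] [Fintype ι] (x : ι) (v : ι → ℂ) :
    ket x ⬝ᵥ v = v x := by
  simp [dotProduct, ket]

lemma complete_aux (M : ℕ) :
    (∑ i : Fin M, (Matrix.vecMulVec (ket ((i.succ, 0) : Fin (M+1) × Fin 2)) (ket (i.succ, 0))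
      + Matrix.vecMulVec (ket ((i.castSucc, 1) : Fin (M+1) × Fin 2)) (ket (i.castSucc, 1))))
    + (Matrix.vecMulVec (ket ((0, 0) : Fin (M+1) × Fin 2)) (ket (0, 0))
      + Matrix.vecMulVec (ket ((Fin.last M, 1) : Fin (M+1) × Fin 2)) (ket (Fin.last M, 1)))
    = (1 : Matrix (Fin (M+1) × Fin 2) (Fin (M+1) × Fin 2) ℂ) := by
  rw [← sum_ket_aux, Fintype.sum_prod_type_right, Fin.sum_univ_two]
  rw [Fin.sum_univ_succ, Fin.sum_univ_castSucc (n := M) (f := fun x =>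
    Matrix.vecMulVec (ket ((x, 1) : Fin (M+1) × Fin 2)) (ket (x, 1))), Finset.sum_add_distrib]
  abel

/-- **Optimal unambiguous discrimination with a uniform-superposition resource
succeeds with probability `M/(M+1)`.** The POVM `{F_+, F_-, F_*}` is complete,
makes no discrimination errors, succeeds with probability `M/(M+1)` and fails
with probability `1/(M+1)` on the twirled states `ρ̄_±`. -/
theorem uniform_resource_UD (M : ℕ) (hM : 1 ≤ M)
    (ψp ψm : Fin (M+1) × Fin 2 → ℂ)
    (hψp : ψp = fun p => ((Real.sqrt (M+1) : ℝ)⁻¹ : ℂ) * (((Real.sqrt 2 : ℝ)⁻¹ : ℂ) *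
      (if p.2 = 0 then 1 else 1)))
    (hψm : ψm = fun p => ((Real.sqrt (M+1) : ℝ)⁻¹ : ℂ) * (((Real.sqrt 2 : ℝ)⁻¹ : ℂ) *
      (if p.2 = 0 then 1 else -1)))
    (ρp ρm : Matrix (Fin (M+1) × Fin 2) (Fin (M+1) × Fin 2) ℂ)
    (hρp : ρp = twirl (fun p : Fin (M+1) × Fin 2 => ((p.1 : ℕ) : ℤ) + ((p.2 : ℕ) : ℤ))
      (Matrix.vecMulVec ψp (star ψp)))
    (hρm : ρm = twirl (fun p : Fin (M+1) × Fin 2 => ((p.1 : ℕ) : ℤ) + ((p.2 : ℕ) : ℤ))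
      (Matrix.vecMulVec ψm (star ψm)))
    (φp φm : Fin M → (Fin (M+1) × Fin 2 → ℂ))
    (hφp : ∀ i : Fin M, φp i = fun p =>
      ((Real.sqrt 2 : ℝ)⁻¹ : ℂ) * (ket ((i.succ, (0 : Fin 2)) : Fin (M+1) × Fin 2) p
        + ket ((i.castSucc, (1 : Fin 2)) : Fin (M+1) × Fin 2) p))
    (hφm : ∀ i : Fin M, φm i = fun p =>
      ((Real.sqrt 2 : ℝ)⁻¹ : ℂ) * (ket ((i.succ, (0 : Fin 2)) : Fin (M+1) × Fin 2) p
        - ket ((i.castSucc, (1 : Fin 2)) : Fin (M+1) × Fin 2) p))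
    (Fp Fm Fs : Matrix (Fin (M+1) × Fin 2) (Fin (M+1) × Fin 2) ℂ)
    (hFp : Fp = ∑ i : Fin M, Matrix.vecMulVec (φp i) (star (φp i)))
    (hFm : Fm = ∑ i : Fin M, Matrix.vecMulVec (φm i) (star (φm i)))
    (hFs : Fs = Matrix.vecMulVec (ket (((0 : Fin (M+1)), (0 : Fin 2)) : Fin (M+1) × Fin 2))
        (star (ket (((0 : Fin (M+1)), (0 : Fin 2)) : Fin (M+1) × Fin 2)))
      + Matrix.vecMulVec (ket ((Fin.last M, (1 : Fin 2)) : Fin (M+1) × Fin 2))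
        (star (ket ((Fin.last M, (1 : Fin 2)) : Fin (M+1) × Fin 2)))) :
    Fp + Fm + Fs = 1 ∧
    (Fp * ρm = 0 ∧ Fm * ρp = 0) ∧
    ((Fp * ρp).trace = (M / (M+1) : ℂ) ∧ (Fm * ρm).trace = (M / (M+1) : ℂ)) ∧
    ((Fs * ρp).trace = (1 / (M+1) : ℂ) ∧ (Fs * ρm).trace = (1 / (M+1) : ℂ)) := by
  have h2 : ((Real.sqrt 2 : ℝ)⁻¹ : ℂ) * ((Real.sqrt 2 : ℝ)⁻¹ : ℂ) = 1 / 2 := by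
    rw [← mul_inv, ← Complex.ofReal_mul, Real.mul_self_sqrt (by norm_num)]
    norm_num
  have hN : ((Real.sqrt (M+1) : ℝ)⁻¹ : ℂ) * ((Real.sqrt (M+1) : ℝ)⁻¹ : ℂ) = 1 / (M + 1) := by
    rw [← mul_inv, ← Complex.ofReal_mul, Real.mul_self_sqrt (by positivity)]
    norm_num
  have hM0 : (M : ℂ) + 1 ≠ 0 := by exact_mod_cast Nat.succ_ne_zero M
  have sc : star ((Real.sqrt 2 : ℝ)⁻¹ : ℂ) = ((Real.sqrt 2 : ℝ)⁻¹ : ℂ) := by simp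
  have sd : star ((Real.sqrt (M+1) : ℝ)⁻¹ : ℂ) = ((Real.sqrt (M+1) : ℝ)⁻¹ : ℂ) := by simp
  generalize ((Real.sqrt 2 : ℝ)⁻¹ : ℂ) = c at *
  generalize ((Real.sqrt (M+1) : ℝ)⁻¹ : ℂ) = d at *
  have hp : ∀ i, φp i = c • (ket (i.succ, 0) + ket (i.castSucc, 1)) := fun i => by
    rw [hφp]; rfl
  have hm : ∀ i, φm i = c • (ket (i.succ, 0) - ket (i.castSucc, 1)) := fun i => by
    rw [hφm]; rfl
  have hsp : ∀ i, star (φp i) = φp i := fun i => by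
    rw [hp, star_smul, star_add, star_ket_aux, star_ket_aux, sc]
  have hsm : ∀ i, star (φm i) = φm i := fun i => by
    rw [hm, star_smul, star_sub, star_ket_aux, star_ket_aux, sc]
  simp only [hsp] at hFp
  simp only [hsm] at hFm
  simp only [star_ket_aux] at hFs
  have hdc : d * c * (d * c) = 1 / (M + 1) / 2 := by
    calc d * c * (d * c) = (d * d) * (c * c) := by ring
      _ = _ := by rw [h2, hN]; ring
  have ep : ∀ p q : Fin (M+1) × Fin 2, ρp p q =
      if ((p.1 : ℕ) : ℤ) + ((p.2 : ℕ) : ℤ) = ((q.1 : ℕ) : ℤ) + ((q.2 : ℕ) : ℤ)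
      then (1 / ((M : ℂ) + 1) / 2 : ℂ) else 0 := by
    intro p q
    rw [hρp, hψp]
    simp only [twirl, Matrix.of_apply, Matrix.vecMulVec_apply, Pi.star_apply, star_mul', sc, sd]
    rw [← hdc]
    congr 1
    simp
  have em : ∀ p q : Fin (M+1) × Fin 2, ρm p q =
      if ((p.1 : ℕ) : ℤ) + ((p.2 : ℕ) : ℤ) = ((q.1 : ℕ) : ℤ) + ((q.2 : ℕ) : ℤ)
      then (1 / ((M : ℂ) + 1) / 2 : ℂ) * ((if p.2 = 0 then 1 else -1) * (if q.2 = 0 then 1 else -1))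
      else 0 := by
    intro p q
    rw [hρm, hψm]
    simp only [twirl, Matrix.of_apply, Matrix.vecMulVec_apply, Pi.star_apply, star_mul', sc, sd]
    rw [← hdc]
    congr 1
    split_ifs <;> simp <;> ring
  refine ⟨?_, ⟨?_, ?_⟩, ⟨?_, ?_⟩, ?_, ?_⟩
  · rw [← complete_aux, hFp, hFm, hFs, ← Finset.sum_add_distrib]
    congr 1
    refine Finset.sum_congr rfl fun i _ => ?_
    ext p q
    simp only [hp, hm, Matrix.add_apply, Matrix.vecMulVec_apply, Pi.smul_apply, Pi.add_apply,
      Pi.sub_apply, smul_eq_mul]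
    linear_combination (2 * (ket (i.succ, 0) p * ket (i.succ, 0) q
      + ket (i.castSucc, 1) p * ket (i.castSucc, 1) q)) * h2
  · rw [hFp, Finset.sum_mul]
    refine Finset.sum_eq_zero fun i _ => ?_
    have : φp i ᵥ* ρm = 0 := by
      rw [hp, Matrix.smul_vecMul, Matrix.add_vecMul, ket_vecMul_aux, ket_vecMul_aux]
      ext q
      simp [em]
      split_ifs <;> simp
    rw [Matrix.vecMulVec_mul, this]
    simp
  · rw [hFm, Finset.sum_mul]
    refine Finset.sum_eq_zero fun i _ => ?_
    have : φm i ᵥ* ρp = 0 := by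
      rw [hm, Matrix.smul_vecMul, Matrix.sub_vecMul, ket_vecMul_aux, ket_vecMul_aux]
      ext q
      simp [ep]
    rw [Matrix.vecMulVec_mul, this]
    simp
  · rw [hFp, Finset.sum_mul, Matrix.trace_sum]
    have : ∀ i, (Matrix.vecMulVec (φp i) (φp i) * ρp).trace = 1 / (M + 1) := by
      intro i
      rw [Matrix.vecMulVec_mul, Matrix.trace_vecMulVec, hp, Matrix.smul_vecMul, Matrix.add_vecMul,
        ket_vecMul_aux, ket_vecMul_aux, smul_dotProduct, dotProduct_smul, add_dotProduct,
        ket_dot_aux, ket_dot_aux]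
      simp only [Pi.add_apply, ep, smul_eq_mul]
      simp
      linear_combination (2 / ((M : ℂ) + 1)) * h2
    simp only [this]
    simp
    ring
  · rw [hFm, Finset.sum_mul, Matrix.trace_sum]
    have : ∀ i, (Matrix.vecMulVec (φm i) (φm i) * ρm).trace = 1 / (M + 1) := by
      intro i
      rw [Matrix.vecMulVec_mul, Matrix.trace_vecMulVec, hm, Matrix.smul_vecMul, Matrix.sub_vecMul,
        ket_vecMul_aux, ket_vecMul_aux, smul_dotProduct, dotProduct_smul, sub_dotProduct,
        ket_dot_aux, ket_dot_aux]
      simp only [Pi.sub_apply, em, smul_eq_mul]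
      simp
      linear_combination (2 / ((M : ℂ) + 1)) * h2
    simp only [this]
    simp
    ring
  · rw [hFs, Matrix.add_mul, Matrix.trace_add, Matrix.vecMulVec_mul, Matrix.vecMulVec_mul,
      Matrix.trace_vecMulVec, Matrix.trace_vecMulVec, ket_vecMul_aux, ket_vecMul_aux,
      ket_dot_aux, ket_dot_aux, ep, ep]
    simp
  · rw [hFs, Matrix.add_mul, Matrix.trace_add, Matrix.vecMulVec_mul, Matrix.vecMulVec_mul,
      Matrix.trace_vecMulVec, Matrix.trace_vecMulVec, ket_vecMul_aux, ket_vecMul_aux,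
      ket_dot_aux, ket_dot_aux, em, em]
    simp
end
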